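/- Let X, Y, Z be varieties over an algebraically closed field k. Suppose there exist a variety V together with modifications V → X and V → Y, and a variety W together with modifications W → Y and W → Z. Then there exists a variety U together with modifications U → X and U → Z. (Equivalence of modification systems — the existence of a common source of modifications — is a transitive relation.) -/

import Mathlib

open AlgebraicGeometry CategoryTheory

/-- A variety over an algebraically closed field `k`: an integral scheme together with
a separated, finite type structure morphism to `Spec k`. -/
structure Variety (k : Type) [Field k] [IsAlgClosed k] where
  carrier : Scheme
  structMap : carrier ⟶ Spec (CommRingCat.of k)
  isIntegral : IsIntegral carrier
  isSeparated : IsSeparated structMap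
  locallyOfFiniteType : LocallyOfFiniteType structMap
  quasiCompact : QuasiCompact structMap

/-- A morphism of schemes `f : V ⟶ X` is birational if there is a dense open subset
`U` of `X` such that `f` restricts to an isomorphism from `f ⁻¹ᵁ U` onto `U`. -/
def IsBirational {V X : Scheme} (f : V ⟶ X) : Prop :=
  ∃ U : X.Opens, Dense (U : Set X) ∧ IsIso (f ∣_ U)

/-- A modification is a proper birational morphism. -/
structure IsModification {V X : Scheme} (f : V ⟶ X) : Prop where
  proper : IsProper f
  birational : IsBirational f

namespace AlgebraicGeometry

/-- If `g` is an isomorphism over `O`, then its base change along `f` is an isomorphism over every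
open subset mapping into `O`. -/
lemma isIso_morphismRestrict_of_isPullback {P V W Y : Scheme} {p : P ⟶ V} {q : P ⟶ W}
    {f : V ⟶ Y} {g : W ⟶ Y} (H : IsPullback p q f g) {O : Y.Opens} (hO : IsIso (g ∣_ O))
    {N : V.Opens} (hN : N ≤ f ⁻¹ᵁ O) : IsIso (p ∣_ N) := by
  have h₁ := (isPullback_morphismRestrict p N).paste_vert H
  rw [← Scheme.Hom.resLE_comp_ι f hN] at h₁
  let l : (p ⁻¹ᵁ N).toScheme ⟶ (g ⁻¹ᵁ O).toScheme :=
    (isPullback_morphismRestrict g O).lift (p ∣_ N ≫ f.resLE O N hN)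
      ((p ⁻¹ᵁ N).ι ≫ q) (by simpa using h₁.w)
  have hl₁ : l ≫ g ∣_ O = p ∣_ N ≫ f.resLE O N hN := IsPullback.lift_fst ..
  have hl₂ : l ≫ (g ⁻¹ᵁ O).ι = (p ⁻¹ᵁ N).ι ≫ q := IsPullback.lift_snd ..
  rw [← hl₂] at h₁
  exact (IsPullback.of_bot h₁ hl₁.symm (isPullback_morphismRestrict g O)).isIso_fst_of_isIso

lemma isIso_morphismRestrict_of_le {X Y : Scheme} (f : X ⟶ Y) {O O' : Y.Opens} (h : O' ≤ O)
    (hO : IsIso (f ∣_ O)) : IsIso (f ∣_ O') :=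
  isIso_morphismRestrict_of_isPullback (IsPullback.of_vert_isIso ⟨by simp⟩ :
    IsPullback f (𝟙 X) (𝟙 Y) f) hO h

lemma nonempty_preimage_of_isIso_morphismRestrict {X Y : Scheme} (f : X ⟶ Y) {O : Y.Opens}
    (hO : IsIso (f ∣_ O)) (h : (O : Set Y).Nonempty) : ((f ⁻¹ᵁ O : X.Opens) : Set X).Nonempty := by
  obtain ⟨y, hy⟩ := h
  exact ⟨_, ((inv (f ∣_ O)) ⟨y, hy⟩).2⟩

lemma injOn_preimage_of_isIso_morphismRestrict {X Y : Scheme} (f : X ⟶ Y) {O : Y.Opens}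
    (hO : IsIso (f ∣_ O)) : Set.InjOn f (f ⁻¹ᵁ O : X.Opens) := by
  intro x hx y hy h
  let x' : (f ⁻¹ᵁ O).toScheme := ⟨x, hx⟩
  let y' : (f ⁻¹ᵁ O).toScheme := ⟨y, hy⟩
  have : x' = y' := (f ∣_ O).injective (Subtype.ext
    ((morphismRestrict_base_coe f O x').trans (h.trans (morphismRestrict_base_coe f O y').symm)))
  exact congr_arg Subtype.val this

lemma isReduced_image {X Y : Scheme} (f : X ⟶ Y) [QuasiCompact f] [IsReduced X] :
    IsReduced f.image := by
  have (U : Y.affineOpens) : IsReduced (Spec (.of (Γ(Y, U) ⧸ f.ker.ideal U))) := by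
    have : _root_.IsReduced (Γ(Y, U) ⧸ f.ker.ideal U) := by
      rw [← Ideal.isRadical_iff_quotient_reduced, f.ker_apply]
      rintro a ⟨n, hn⟩
      rw [RingHom.mem_ker, map_pow] at hn
      exact IsReduced.eq_zero _ ⟨n, hn⟩
    infer_instance
  have : ∀ i, IsReduced (f.ker.subschemeCover.openCover.X i) := this
  exact IsReduced.of_openCover _ f.ker.subschemeCover.openCover

lemma isIntegral_image {X Y : Scheme} (f : X ⟶ Y) [QuasiCompact f] [IsIntegral X] :
    IsIntegral f.image := by
  have := isReduced_image f
  have : IrreducibleSpace f.image := by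
    rw [irreducibleSpace_def, Set.top_eq_univ, ← f.toImage.denseRange.closure_range,
      isIrreducible_iff_closure, ← Set.image_univ]
    exact (IrreducibleSpace.isIrreducible_univ X).image _ f.toImage.continuous.continuousOn
  exact isIntegral_of_irreducibleSpace_of_isReduced _

/-- The scheme-theoretic closure of a reduced open subscheme agrees with it over that open. -/
lemma isIso_imageι_morphismRestrict {P : Scheme} (Q : P.Opens) [IsReduced Q] {Q' : P.Opens}
    (h : Q' ≤ Q) : IsIso (Q.ι.imageι ∣_ Q') := by
  have : IsReduced Q' := isReduced_of_isOpenImmersion (P.homOfLE h)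
  have : Surjective (Q.ι.imageι ∣_ Q') := by
    refine ⟨fun ⟨x, hx⟩ ↦ ?_⟩
    let y : Q.toScheme := ⟨x, h hx⟩
    have hy : Q.ι.imageι (Q.ι.toImage y) = x := by
      rw [← Scheme.Hom.comp_apply, Q.ι.toImage_imageι]
      rfl
    let z : (Q.ι.imageι ⁻¹ᵁ Q').toScheme := ⟨Q.ι.toImage y, hy.symm.subst (motive := (· ∈ Q')) hx⟩
    exact ⟨z, Subtype.ext ((morphismRestrict_base_coe _ _ z).trans hy)⟩
  exact isIso_of_isClosedImmersion_of_surjective _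

end AlgebraicGeometry

lemma IsBirational.exists_nonempty {V X : Scheme} [Nonempty X] {f : V ⟶ X} (hf : IsBirational f) :
    ∃ O : X.Opens, (O : Set X).Nonempty ∧ IsIso (f ∣_ O) :=
  let ⟨O, hO, hf⟩ := hf
  ⟨O, hO.nonempty, hf⟩

lemma IsBirational.of_nonempty {V X : Scheme} [IrreducibleSpace X] {f : V ⟶ X} {O : X.Opens}
    (hO : (O : Set X).Nonempty) (hf : IsIso (f ∣_ O)) : IsBirational f :=
  ⟨O, O.2.dense hO, hf⟩

lemma IsModification.comp {A B C : Scheme} [IrreducibleSpace B] [IrreducibleSpace C]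
    {f : A ⟶ B} {g : B ⟶ C} (hf : IsModification f) (hg : IsModification g) :
    IsModification (f ≫ g) := by
  have := hf.proper
  have := hg.proper
  refine ⟨inferInstance, ?_⟩
  obtain ⟨O, hO, hfO⟩ := hf.birational.exists_nonempty
  obtain ⟨O', hO', hgO'⟩ := hg.birational.exists_nonempty
  let T : C.Opens := ⟨(g '' (O : Set B)ᶜ)ᶜ, (g.isClosedMap _ O.2.isClosed_compl).isOpen_compl⟩
  have hT : g ⁻¹ᵁ (O' ⊓ T) ≤ O := fun x hx ↦ by
    by_contra hxO
    exact hx.2 ⟨x, hxO, rfl⟩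
  have hne : ((O' ⊓ T : C.Opens) : Set C).Nonempty := by
    obtain ⟨x, hx, hxO⟩ := nonempty_preirreducible_inter (g ⁻¹ᵁ O').2 O.2
      (nonempty_preimage_of_isIso_morphismRestrict g hgO' hO') hO
    refine ⟨g x, hx, ?_⟩
    rintro ⟨y, hy, hyx⟩
    have hy' : y ∈ g ⁻¹ᵁ O' := by
      change g y ∈ O'
      rwa [hyx]
    exact hy (injOn_preimage_of_isIso_morphismRestrict g hgO' hy' hx hyx ▸ hxO)
  refine .of_nonempty hne ?_
  rw [morphismRestrict_comp]
  exact IsIso.comp_isIso' (isIso_morphismRestrict_of_le f hT hfO)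
    (isIso_morphismRestrict_of_le g inf_le_left hgO')

/-- Two modifications of an integral locally Noetherian scheme are dominated by a third one,
namely the main component of their fibre product. -/
lemma IsModification.exists_common {V W Y : Scheme} [IsIntegral V] [IsIntegral W]
    [IsLocallyNoetherian V] [IsIntegral Y]
    {f : V ⟶ Y} {g : W ⟶ Y} (hf : IsModification f) (hg : IsModification g) :
    ∃ (U : Scheme) (p : U ⟶ V) (q : U ⟶ W),
      IsIntegral U ∧ IsModification p ∧ IsModification q := by
  have := hf.proper
  have := hg.proper
  obtain ⟨O₁, hO₁, hfO⟩ := hf.birational.exists_nonempty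
  obtain ⟨O₂, hO₂, hgO⟩ := hg.birational.exists_nonempty
  have hO : ((O₁ ⊓ O₂ : Y.Opens) : Set Y).Nonempty :=
    nonempty_preirreducible_inter O₁.2 O₂.2 hO₁ hO₂
  replace hfO := isIso_morphismRestrict_of_le f inf_le_left hfO (O' := O₁ ⊓ O₂)
  replace hgO := isIso_morphismRestrict_of_le g inf_le_right hgO (O' := O₁ ⊓ O₂)
  generalize O₁ ⊓ O₂ = O at hO hfO hgO
  have H := IsPullback.of_hasPullback f g
  have hp := isIso_morphismRestrict_of_isPullback H hgO le_rfl
  have hq := isIso_morphismRestrict_of_isPullback H.flip hfO le_rfl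
  have hV := nonempty_preimage_of_isIso_morphismRestrict f hfO hO
  have hW := nonempty_preimage_of_isIso_morphismRestrict g hgO hO
  let Q : (Limits.pullback f g).Opens := Limits.pullback.fst f g ⁻¹ᵁ f ⁻¹ᵁ O
  have hQ : Limits.pullback.snd f g ⁻¹ᵁ g ⁻¹ᵁ O ≤ Q := by
    simp only [Q, ← Scheme.Hom.comp_preimage, Limits.pullback.condition]
    exact le_rfl
  have : Nonempty (f ⁻¹ᵁ O).toScheme := hV.to_subtype
  have : IsIntegral (f ⁻¹ᵁ O).toScheme := isIntegral_of_isOpenImmersion (f ⁻¹ᵁ O).ι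
  have : IsIntegral Q.toScheme := IsIntegral.of_isIso (inv (Limits.pullback.fst f g ∣_ f ⁻¹ᵁ O))
  refine ⟨Q.ι.image, Q.ι.imageι ≫ Limits.pullback.fst f g, Q.ι.imageι ≫ Limits.pullback.snd f g,
    isIntegral_image Q.ι, ⟨inferInstance, .of_nonempty hV ?_⟩, ⟨inferInstance, .of_nonempty hW ?_⟩⟩
  · rw [morphismRestrict_comp]
    exact IsIso.comp_isIso' (isIso_imageι_morphismRestrict Q le_rfl) hp
  · rw [morphismRestrict_comp]
    exact IsIso.comp_isIso' (isIso_imageι_morphismRestrict Q hQ) hq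

/-- Equivalence of modification systems is transitive: if `X` and `Y` admit
modifications from a common variety `V`, and `Y` and `Z` admit modifications from a
common variety `W`, then `X` and `Z` admit modifications from a common variety `U`. -/
theorem equivalence_transitive {k : Type} [Field k] [IsAlgClosed k]
    (X Y Z V W : Variety k)
    (πVX : V.carrier ⟶ X.carrier) (hVX : IsModification πVX)
    (πVY : V.carrier ⟶ Y.carrier) (hVY : IsModification πVY)
    (πWY : W.carrier ⟶ Y.carrier) (hWY : IsModification πWY)
    (πWZ : W.carrier ⟶ Z.carrier) (hWZ : IsModification πWZ) :
    ∃ (U : Variety k) (πUX : U.carrier ⟶ X.carrier) (πUZ : U.carrier ⟶ Z.carrier),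
      IsModification πUX ∧ IsModification πUZ := by
  have := X.isIntegral
  have := Y.isIntegral
  have := Z.isIntegral
  have := V.isIntegral
  have := W.isIntegral
  have := V.locallyOfFiniteType
  have : IsLocallyNoetherian V.carrier := LocallyOfFiniteType.isLocallyNoetherian V.structMap
  obtain ⟨U, p, q, hU, hp, hq⟩ := hVY.exists_common hWY
  have hX := hp.comp hVX
  have := hX.proper
  have := X.isSeparated
  have := X.locallyOfFiniteType
  have := X.quasiCompact
  exact ⟨⟨U, (p ≫ πVX) ≫ X.structMap, hU, inferInstance, inferInstance, inferInstance⟩,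
    p ≫ πVX, q ≫ πWZ, hX, hq.comp hWZ⟩
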